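/- Let (V, E, tail, head) be a finite Eulerian directed multigraph (for every v ∈ V, |tail⁻¹(v)| = |head⁻¹(v)|) whose maximum out-degree is at most Δ. Then E can be partitioned into Δ sets E₁, …, E_Δ such that each E_i is a directed polycycle, i.e., for every vertex v, |tail⁻¹(v) ∩ E_i| = |head⁻¹(v) ∩ E_i| ≤ 1. Moreover, for any integer 0 ≤ t ≤ Δ, if at most one vertex v has out-degree |tail⁻¹(v)| > t, then E_{t+1}, …, E_Δ can additionally be chosen so that each of them is either empty or a single directed cycle (its edges can be enumerated e₁, …, e_k with head(e_j) = tail(e_{j+1}) for j < k, head(e_k) = tail(e₁), and tail(e₁), …, tail(e_k) pairwise distinct). -/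

import Mathlib

/-- The number of elements of `S` that `φ` sends to `v`. With `φ = tail` or `φ = head` this is the
out-degree or in-degree of `v` in the arc set `S`. -/
def fiberCard {E V : Type*} [DecidableEq V] (φ : E → V) (S : Finset E) (v : V) : ℕ :=
  (S.filter fun e => φ e = v).card

/-- Every vertex has the same out-degree and in-degree in the arc set `S`. -/
def IsBalanced {E V : Type*} [DecidableEq V] (tail head : E → V) (S : Finset E) : Prop :=
  ∀ v, fiberCard tail S v = fiberCard head S v

/-- The arc set `M` is a directed polycycle. -/
def IsPolycycle {E V : Type*} [DecidableEq V] (tail head : E → V) (M : Finset E) : Prop :=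
  IsBalanced tail head M ∧ ∀ v, fiberCard tail M v ≤ 1

/-- The arc set `C` is a single directed cycle. -/
def IsDirectedCycle {E V : Type*} (tail head : E → V) (C : Finset E) : Prop :=
  ∃ (k : ℕ) (hk : 0 < k) (g : Fin k → E), Function.Injective g ∧
    (∀ e, e ∈ C ↔ e ∈ Set.range g) ∧
    (∀ j : Fin k, head (g j) = tail (g ⟨(j.val + 1) % k, Nat.mod_lt _ hk⟩)) ∧
    Function.Injective fun j : Fin k => tail (g j)

section FiberCard

variable {E V : Type*} [DecidableEq V]

theorem fiberCard_mono (φ : E → V) {S T : Finset E} (h : S ⊆ T) (v : V) :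
    fiberCard φ S v ≤ fiberCard φ T v :=
  Finset.card_le_card (Finset.filter_subset_filter _ h)

theorem fiberCard_sdiff_add [DecidableEq E] (φ : E → V) {S C : Finset E} (h : C ⊆ S) (v : V) :
    fiberCard φ (S \ C) v + fiberCard φ C v = fiberCard φ S v := by
  unfold fiberCard
  rw [← Finset.card_union_of_disjoint, ← Finset.filter_union, Finset.sdiff_union_of_subset h]
  exact Finset.disjoint_filter_filter Finset.sdiff_disjoint

theorem fiberCard_pos {φ : E → V} {S : Finset E} {v : V} :
    0 < fiberCard φ S v ↔ ∃ e ∈ S, φ e = v := by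
  simp [fiberCard, Finset.card_pos, Finset.Nonempty]

theorem fiberCard_le_one {φ : E → V} {S : Finset E} {v : V} (h : fiberCard φ S v ≤ 1)
    {a b : E} (ha : a ∈ S) (hb : b ∈ S) (hav : φ a = v) (hbv : φ b = v) : a = b :=
  Finset.card_le_one.1 h a (by simp [ha, hav]) b (by simp [hb, hbv])

theorem sum_fiberCard (φ : E → V) (S : Finset E) (A : Finset V) :
    ∑ v ∈ A, fiberCard φ S v = (S.filter fun e => φ e ∈ A).card := by
  rw [Finset.card_eq_sum_card_fiberwise (f := φ) (t := A)]
  · refine Finset.sum_congr rfl fun v hv => ?_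
    rw [Finset.filter_filter]
    refine congrArg _ (Finset.filter_congr fun e _ => ?_)
    constructor
    · rintro rfl
      exact ⟨hv, rfl⟩
    · exact fun h => h.2
  · intro e he
    simpa using (Finset.mem_filter.1 he).2

theorem IsBalanced.sdiff [DecidableEq E] {tail head : E → V} {S C : Finset E}
    (hS : IsBalanced tail head S) (hC : IsBalanced tail head C) (h : C ⊆ S) :
    IsBalanced tail head (S \ C) := by
  intro v
  have h₁ := fiberCard_sdiff_add tail h v
  have h₂ := fiberCard_sdiff_add head h v
  have h₃ := hS v
  have h₄ := hC v
  omega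

/-- An injective self-map of `C` sending each arc to one starting at its head witnesses
balancedness. -/
theorem isBalanced_of_successor [Fintype V] {tail head : E → V} {C : Finset E} (ν : E → E)
    (hν : ∀ e ∈ C, ν e ∈ C) (hinj : Set.InjOn ν C) (hsucc : ∀ e ∈ C, tail (ν e) = head e) :
    IsBalanced tail head C := by
  have hle : ∀ v ∈ Finset.univ, fiberCard head C v ≤ fiberCard tail C v := by
    intro v _
    refine Finset.card_le_card_of_injOn ν ?_ ?_
    · intro e he
      have he := Finset.mem_filter.1 he
      simp [hν e he.1, hsucc e he.1, he.2]
    · exact hinj.mono (by intro e he; exact (Finset.mem_filter.1 he).1)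
  have hsum : ∑ v, fiberCard head C v = ∑ v, fiberCard tail C v := by
    simp [sum_fiberCard]
  intro v
  exact ((Finset.sum_eq_sum_iff_of_le hle).1 hsum v (Finset.mem_univ v)).symm

end FiberCard

/-- A colouring of `S \ C` with `n` colours extends to `S` by giving `C` a new colour. -/
theorem exists_coloring_of_sdiff {E : Type*} [DecidableEq E] {Q : ℕ → Finset E → Prop} {S C : Finset E}
    {n : ℕ} (hCS : C ⊆ S) (hC : Q n C)
    (h : ∃ f : E → ℕ, (∀ e ∈ S \ C, f e < n) ∧ ∀ i < n, Q i ((S \ C).filter fun e => f e = i)) :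
    ∃ f : E → ℕ, (∀ e ∈ S, f e < n + 1) ∧ ∀ i < n + 1, Q i (S.filter fun e => f e = i) := by
  obtain ⟨f, hf, hQ⟩ := h
  simp only [Finset.mem_sdiff] at hf
  refine ⟨fun e => if e ∈ C then n else f e, ?_, ?_⟩
  · intro e he
    have := hf e
    grind
  · intro i hi
    rcases Nat.lt_succ_iff_lt_or_eq.1 hi with hi | rfl
    · convert hQ i hi using 1
      ext e
      simp only [Finset.mem_filter, Finset.mem_sdiff]
      grind
    · convert hC using 1
      ext e
      have h₁ := hf e
      have h₂ := @hCS e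
      simp only [Finset.mem_filter]
      grind

section Decomposition

variable {E V : Type*} [DecidableEq V] [Fintype V]

/-- A balanced arc set of maximum degree at most `d` has a selection of arcs, at most one leaving
each vertex, that realises a permutation of the vertices apart from fixed points of degree less
than `d`. -/
theorem exists_perm_of_isBalanced {tail head : E → V} {S : Finset E} {d : ℕ} (hd : 0 < d)
    (hS : IsBalanced tail head S) (hdeg : ∀ v, fiberCard tail S v ≤ d) :
    ∃ σ : Equiv.Perm V, ∀ v,
      (∃ e ∈ S, tail e = v ∧ head e = σ v) ∨ (fiberCard tail S v < d ∧ σ v = v) := by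
  let N : V → Finset V := fun v =>
    ((S.filter fun e => tail e = v).image head) ∪ (if fiberCard tail S v < d then {v} else ∅)
  have hall : ∀ A : Finset V, A.card ≤ (A.biUnion N).card := by
    intro A
    have h₁ : ∑ v ∈ A, fiberCard tail S v ≤ ∑ v ∈ A.biUnion N, fiberCard tail S v := by
      rw [Finset.sum_congr rfl fun v (_ : v ∈ A.biUnion N) => hS v, sum_fiberCard, sum_fiberCard]
      refine Finset.card_le_card fun e he => ?_
      rw [Finset.mem_filter] at he ⊢
      refine ⟨he.1, Finset.mem_biUnion.2 ⟨tail e, he.2, Finset.mem_union_left _ ?_⟩⟩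
      exact Finset.mem_image.2 ⟨e, by simp [he.1], rfl⟩
    have h₂ : ∑ v ∈ A, (d - fiberCard tail S v) ≤
        ∑ v ∈ A.biUnion N, (d - fiberCard tail S v) := by
      refine Finset.sum_le_sum_of_ne_zero fun v hv hne => ?_
      refine Finset.mem_biUnion.2 ⟨v, hv, Finset.mem_union_right _ ?_⟩
      rw [if_pos (by omega)]
      exact Finset.mem_singleton_self v
    have h₃ : ∀ B : Finset V,
        ∑ v ∈ B, fiberCard tail S v + ∑ v ∈ B, (d - fiberCard tail S v) = B.card * d := by
      intro B
      rw [← Finset.sum_add_distrib, Finset.sum_const_nat]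
      intro v _
      have := hdeg v
      omega
    have h₄ := h₃ A
    have h₅ := h₃ (A.biUnion N)
    exact Nat.le_of_mul_le_mul_right (by omega) hd
  obtain ⟨σ, hσ, hmem⟩ := (Finset.all_card_le_biUnion_card_iff_exists_injective N).1 hall
  refine ⟨Equiv.ofBijective σ (Finite.injective_iff_bijective.1 hσ), fun v => ?_⟩
  rcases Finset.mem_union.1 (hmem v) with h | h
  · obtain ⟨e, he, hev⟩ := Finset.mem_image.1 h
    rw [Finset.mem_filter] at he
    exact Or.inl ⟨e, he.1, he.2, hev⟩
  · right
    split_ifs at h with hlt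
    · exact ⟨hlt, Finset.mem_singleton.1 h⟩
    · simp at h

/-- A balanced arc set of maximum degree at most `d` contains a polycycle through all vertices of
degree `d`. -/
theorem exists_isPolycycle_of_isBalanced {tail head : E → V} {S : Finset E} {d : ℕ} (hd : 0 < d)
    (hS : IsBalanced tail head S) (hdeg : ∀ v, fiberCard tail S v ≤ d) :
    ∃ M ⊆ S, IsPolycycle tail head M ∧ ∀ v, fiberCard tail S v = d → 0 < fiberCard tail M v := by
  classical
  rcases isEmpty_or_nonempty E with hE | hE
  · refine ⟨∅, Finset.empty_subset S, ⟨fun v => by simp [fiberCard],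
      fun v => by simp [fiberCard]⟩, fun v hv => ?_⟩
    obtain ⟨e, -⟩ := fiberCard_pos.1 (hd.trans_eq hv.symm)
    exact hE.elim e
  obtain ⟨σ, hσ⟩ := exists_perm_of_isBalanced hd hS hdeg
  let P : V → Prop := fun v => ∃ e ∈ S, tail e = v ∧ head e = σ v
  have hP : ∀ v, ¬ P v → fiberCard tail S v < d ∧ σ v = v := fun v hv => (hσ v).resolve_left hv
  choose! a haS hat hah using fun (v : V) (hv : P v) => hv
  let M : Finset E := (Finset.univ.filter P).image a
  have hM : ∀ e, e ∈ M ↔ ∃ v, P v ∧ a v = e := by simp [M]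
  have hσP : ∀ v, P v → P (σ v) := by
    intro v hv
    by_contra hn
    have h := σ.injective (hP _ hn).2
    exact hn (h.symm ▸ hv)
  refine ⟨M, ?_, ⟨?_, ?_⟩, ?_⟩
  · intro e he
    obtain ⟨v, hv, rfl⟩ := (hM e).1 he
    exact haS v hv
  · refine isBalanced_of_successor (fun e => a (head e)) ?_ ?_ ?_
    · intro e he
      obtain ⟨v, hv, rfl⟩ := (hM e).1 he
      exact (hM _).2 ⟨head (a v), by rw [hah v hv]; exact hσP v hv, rfl⟩
    · intro e he e' he' h
      obtain ⟨v, hv, rfl⟩ := (hM e).1 he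
      obtain ⟨w, hw, rfl⟩ := (hM e').1 he'
      have h' := congrArg tail h
      simp only [hah v hv, hah w hw] at h'
      rw [hat _ (hσP v hv), hat _ (hσP w hw)] at h'
      rw [σ.injective h']
    · intro e he
      obtain ⟨v, hv, rfl⟩ := (hM e).1 he
      rw [hah v hv]
      exact hat _ (hσP v hv)
  · intro v
    refine Finset.card_le_one.2 fun e he e' he' => ?_
    obtain ⟨he, hev⟩ := Finset.mem_filter.1 he
    obtain ⟨he', hev'⟩ := Finset.mem_filter.1 he'
    obtain ⟨x, hx, rfl⟩ := (hM e).1 he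
    obtain ⟨y, hy, rfl⟩ := (hM e').1 he'
    rw [hat x hx] at hev
    rw [hat y hy] at hev'
    rw [hev, hev']
  · intro v hv
    have hPv : P v := by
      by_contra hn
      exact absurd (hP v hn).1 (by omega)
    exact fiberCard_pos.2 ⟨a v, (hM _).2 ⟨v, hPv, rfl⟩, hat v hPv⟩

/-- Every vertex on a polycycle lies on a directed cycle contained in it. -/
theorem IsPolycycle.exists_isDirectedCycle {tail head : E → V} {M : Finset E}
    (hM : IsPolycycle tail head M) {v : V} (hv : 0 < fiberCard tail M v) :
    ∃ C ⊆ M, IsPolycycle tail head C ∧ IsDirectedCycle tail head C ∧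
      0 < fiberCard tail C v := by
  classical
  obtain ⟨hbal, hone⟩ := hM
  have hnext : ∀ e : M, ∃ e' : M, tail e' = head e := by
    intro e
    have h : 0 < fiberCard tail M (head e) := by
      rw [hbal]
      exact fiberCard_pos.2 ⟨e, e.2, rfl⟩
    obtain ⟨e', he', h⟩ := fiberCard_pos.1 h
    exact ⟨⟨e', he'⟩, h⟩
  choose ν hν using hnext
  have htail : ∀ a b : M, tail a = tail b → a = b := fun a b h =>
    Subtype.ext (fiberCard_le_one (hone _) a.2 b.2 h rfl)
  have hinj : Function.Injective ν := by
    intro a b h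
    have h' : head a = head b := by rw [← hν, ← hν, h]
    exact Subtype.ext (fiberCard_le_one ((hbal _).symm.trans_le (hone _)) a.2 b.2 h' rfl)
  obtain ⟨e₀, he₀, he₀v⟩ := fiberCard_pos.1 hv
  let x : M := ⟨e₀, he₀⟩
  have hper : x ∈ Function.periodicPts ν := hinj.mem_periodicPts x
  have hk : 0 < Function.minimalPeriod ν x := Function.minimalPeriod_pos_of_mem_periodicPts hper
  let k := Function.minimalPeriod ν x
  let C : Finset E := M.filter fun e => ∃ n : ℕ, (ν^[n] x : E) = e
  have hCM : C ⊆ M := Finset.filter_subset _ _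
  have hC : ∀ e, e ∈ C ↔ ∃ n : ℕ, (ν^[n] x : E) = e := by
    intro e
    rw [Finset.mem_filter]
    refine ⟨fun h => h.2, fun h => ⟨?_, h⟩⟩
    obtain ⟨n, rfl⟩ := h
    exact (ν^[n] x).2
  have hginj : Function.Injective fun j : Fin k => ν^[j] x := by
    intro i j h
    exact Fin.ext ((Function.iterate_eq_iterate_iff_of_lt_minimalPeriod i.2 j.2).1 h)
  refine ⟨C, hCM, ⟨?_, fun w => (fiberCard_mono tail hCM w).trans (hone w)⟩,
    ⟨k, hk, fun j => (ν^[j] x : E), Subtype.val_injective.comp hginj, ?_, ?_, ?_⟩,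
    fiberCard_pos.2 ⟨e₀, (hC _).2 ⟨0, rfl⟩, he₀v⟩⟩
  · refine isBalanced_of_successor (fun e => if h : e ∈ M then (ν ⟨e, h⟩ : E) else e) ?_ ?_ ?_
    · intro e he
      obtain ⟨n, rfl⟩ := (hC e).1 he
      refine (hC _).2 ⟨n + 1, ?_⟩
      simp [Function.iterate_succ_apply']
    · intro e he e' he' h
      simp only [hCM he, hCM he', dif_pos] at h
      exact congrArg Subtype.val (hinj (Subtype.ext h))
    · intro e he
      simp only [hCM he, dif_pos]
      exact hν _
  · intro e
    rw [hC]
    constructor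
    · rintro ⟨n, rfl⟩
      exact ⟨⟨n % k, Nat.mod_lt _ hk⟩, by
        simp only [k, Function.iterate_mod_minimalPeriod_eq]⟩
    · rintro ⟨j, rfl⟩
      exact ⟨j, rfl⟩
  · intro j
    simp only [k, Function.iterate_mod_minimalPeriod_eq, Function.iterate_succ_apply']
    exact (hν _).symm
  · intro i j h
    exact hginj (htail _ _ h)

/-- The decomposition into polycycles, for a balanced set of arcs. -/
theorem IsBalanced.exists_coloring {tail head : E → V} (t Δ : ℕ) :
    ∀ S : Finset E, IsBalanced tail head S → (∀ v, fiberCard tail S v ≤ Δ) →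
      (∀ v w, t < fiberCard tail S v → t < fiberCard tail S w → v = w) →
      ∃ f : E → ℕ, (∀ e ∈ S, f e < Δ) ∧ ∀ i < Δ,
        IsPolycycle tail head (S.filter fun e => f e = i) ∧
          (t ≤ i → (S.filter fun e => f e = i) = ∅ ∨
            IsDirectedCycle tail head (S.filter fun e => f e = i)) := by
  induction Δ with
  | zero =>
    intro S _ hdeg _
    refine ⟨fun _ => 0, fun e he => ?_, fun i hi => absurd hi (Nat.not_lt_zero i)⟩
    exact absurd (hdeg (tail e)) (not_le.2 (fiberCard_pos.2 ⟨e, he, rfl⟩))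
  | succ n ih =>
    intro S hS hdeg huniq
    suffices h : ∃ C ⊆ S, (IsPolycycle tail head C ∧
        (t ≤ n → C = ∅ ∨ IsDirectedCycle tail head C)) ∧
        ∀ v, fiberCard tail S v = n + 1 → 0 < fiberCard tail C v by
      obtain ⟨C, hCS, hC, hcover⟩ := h
      classical
      refine exists_coloring_of_sdiff (Q := fun i M => IsPolycycle tail head M ∧
        (t ≤ i → M = ∅ ∨ IsDirectedCycle tail head M)) hCS hC
        (ih (S \ C) (hS.sdiff hC.1.1 hCS) (fun v => ?_) fun v w hv hw => huniq v w ?_ ?_)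
      · have h₁ := fiberCard_sdiff_add tail hCS v
        have h₂ := hdeg v
        have h₃ := hcover v
        omega
      · exact hv.trans_le (fiberCard_mono tail Finset.sdiff_subset v)
      · exact hw.trans_le (fiberCard_mono tail Finset.sdiff_subset w)
    obtain ⟨M, hMS, hM, hcover⟩ := exists_isPolycycle_of_isBalanced n.succ_pos hS hdeg
    by_cases htn : t ≤ n
    · by_cases hv : ∃ v, fiberCard tail S v = n + 1
      · obtain ⟨v, hv⟩ := hv
        obtain ⟨C, hCM, hC, hcyc, hCv⟩ := hM.exists_isDirectedCycle (hcover v hv)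
        refine ⟨C, hCM.trans hMS, ⟨hC, fun _ => Or.inr hcyc⟩, fun w hw => ?_⟩
        rwa [huniq w v (by omega) (by omega)]
      · exact ⟨∅, Finset.empty_subset S, ⟨⟨fun v => by simp [fiberCard],
          fun v => by simp [fiberCard]⟩, fun _ => Or.inl rfl⟩, fun v h => absurd ⟨v, h⟩ hv⟩
    · exact ⟨M, hMS, ⟨hM, fun h => absurd h htn⟩, hcover⟩

end Decomposition


/-- Every Eulerian directed multigraph of maximum out-degree at most `Δ` can be
decomposed into `Δ` directed polycycles; moreover, if `t ≤ Δ` and at most one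
vertex has out-degree exceeding `t`, then the classes indexed `t, …, Δ-1` can be
chosen to be empty or single directed cycles. -/
theorem eulerian_digraph_polycycle_decomposition
    (V E : Type*) [Fintype V] [Fintype E] [DecidableEq V] [DecidableEq E]
    (tail head : E → V) (Δ t : ℕ)
    (hEuler : ∀ v, (Finset.univ.filter fun e => tail e = v).card
      = (Finset.univ.filter fun e => head e = v).card)
    (hdeg : ∀ v, (Finset.univ.filter fun e => tail e = v).card ≤ Δ)
    (ht : t ≤ Δ)
    (hone : ({v | t < (Finset.univ.filter fun e => tail e = v).card} : Set V).Subsingleton) :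
    ∃ f : E → Fin Δ,
      (∀ (i : Fin Δ) (v : V),
        (Finset.univ.filter fun e => tail e = v ∧ f e = i).card
          = (Finset.univ.filter fun e => head e = v ∧ f e = i).card ∧
        (Finset.univ.filter fun e => tail e = v ∧ f e = i).card ≤ 1) ∧
      (∀ i : Fin Δ, t ≤ i.val →
        (∀ e, f e ≠ i) ∨
        ∃ (k : ℕ) (hk : 0 < k) (g : Fin k → E),
          Function.Injective g ∧
          (∀ e, f e = i ↔ e ∈ Set.range g) ∧
          (∀ j : Fin k, head (g j) = tail (g ⟨(j.val + 1) % k, Nat.mod_lt _ hk⟩)) ∧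
          Function.Injective fun j : Fin k => tail (g j)) := by
  obtain ⟨f, hf, hQ⟩ := IsBalanced.exists_coloring (tail := tail) (head := head) t Δ Finset.univ
    hEuler hdeg fun v w hv hw => hone hv hw
  refine ⟨fun e => ⟨f e, hf e (Finset.mem_univ e)⟩, fun i v => ?_, fun i hi => ?_⟩
  · obtain ⟨⟨hbal, hle⟩, -⟩ := hQ i i.2
    have h : ∀ φ : E → V,
        (Finset.univ.filter fun e => φ e = v ∧
          (⟨f e, hf e (Finset.mem_univ e)⟩ : Fin Δ) = i).card =
        fiberCard φ (Finset.univ.filter fun e => f e = i) v := by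
      intro φ
      rw [fiberCard, Finset.filter_filter]
      simp only [Fin.ext_iff, and_comm]
    rw [h tail, h head]
    exact ⟨hbal v, hle v⟩
  · rcases (hQ i i.2).2 hi with h | ⟨k, hk, g, hg, hmem, hcyc⟩
    · left
      intro e he
      exact Finset.filter_eq_empty_iff.1 h (Finset.mem_univ e) (Fin.ext_iff.1 he)
    · refine Or.inr ⟨k, hk, g, hg, fun e => ?_, hcyc⟩
      rw [← hmem e]
      simp [Fin.ext_iff]
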